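/- Let κ and κ̃ be nonzero positive Radon measures on ℝ with κ ≤ κ̃ and ∫_ℝ |x| (κ̃ − κ)(dx) < +∞. Let (u↑, u↓) be a pair of solutions of (1/2)u″ = uκ on ℝ, with u↑ positive non-decreasing, u↓ positive non-increasing, and Wronskian u↓·g↑ − u↑·g↓ identically equal to 2; let (ũ↑, ũ↓) be the analogous normalized pair of solutions of (1/2)u″ = uκ̃. Then there exist constants c₁ > 0 and c₂ > 0 such that for every x ∈ ℝ: ∫_{(−∞,x)} ( u↓(y)u↑(x) − u↑(y)u↓(x) ) ũ↑(y) (κ̃−κ)(dy) = ũ↑(x) − c₁·u↑(x), and ∫_{(x,+∞)} ( u↑(y)u↓(x) − u↓(y)u↑(x) ) ũ↓(y) (κ̃−κ)(dy) = ũ↓(x) − c₂·u↓(x). -/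

import Mathlib

open MeasureTheory Set

/-- `u` is a solution of `(1/2) u'' = u κ` on `ℝ`, where `κ` is a positive Radon
measure, and `g` is the right-continuous right-derivative of `u`. -/
def IsSolKappaR (κ : Measure ℝ) (u g : ℝ → ℝ) : Prop :=
  Continuous u ∧
  (∀ x : ℝ, ContinuousWithinAt g (Ici x) x) ∧
  (∀ x' x : ℝ, u x = u x' + ∫ t in x'..x, g t) ∧
  (∀ x' x : ℝ, x' ≤ x → g x - g x' = 2 * ∫ t in Ioc x' x, u t ∂κ)

open Filter Topology

lemma isLocallyFiniteMeasure_add (κ μ : Measure ℝ) [IsLocallyFiniteMeasure κ]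
    [IsLocallyFiniteMeasure μ] : IsLocallyFiniteMeasure (κ + μ) := by
  refine ⟨fun x => ?_⟩
  obtain ⟨s, hs, hsκ⟩ := κ.finiteAt_nhds x
  obtain ⟨t, ht, htμ⟩ := μ.finiteAt_nhds x
  refine ⟨s ∩ t, Filter.inter_mem hs ht, ?_⟩
  rw [Measure.add_apply]
  exact ENNReal.add_lt_top.2 ⟨(measure_mono inter_subset_left).trans_lt hsκ,
    (measure_mono inter_subset_right).trans_lt htμ⟩

namespace IsSolKappaR

variable {κ μ ν : Measure ℝ} {u v g γ : ℝ → ℝ}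

lemma monotone_deriv (h : IsSolKappaR κ u g) (hu : ∀ x, 0 < u x) : Monotone g := by
  intro x y hxy
  have h1 := h.2.2.2 x y hxy
  have h2 : 0 ≤ ∫ t in Ioc x y, u t ∂κ := integral_nonneg fun t => (hu t).le
  linarith

lemma secant_bounds (h : IsSolKappaR κ u g) (hu : ∀ x, 0 < u x) {x y : ℝ} (hxy : x ≤ y) :
    g x * (y - x) ≤ u y - u x ∧ u y - u x ≤ g y * (y - x) := by
  have hm := h.monotone_deriv hu
  have hi : IntervalIntegrable g volume x y := hm.intervalIntegrable
  have he : u y - u x = ∫ t in x..y, g t := by rw [h.2.2.1 x y]; ring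
  rw [he]
  constructor
  · have := intervalIntegral.integral_mono_on hxy intervalIntegrable_const hi
      (fun t ht => hm ht.1 : ∀ t ∈ Icc x y, g x ≤ g t)
    simpa [mul_comm] using this
  · have := intervalIntegral.integral_mono_on hxy hi intervalIntegrable_const
      (fun t ht => hm ht.2 : ∀ t ∈ Icc x y, g t ≤ g y)
    simpa [mul_comm] using this

/-- Integration by parts for the product of a solution and the derivative of another one. -/
lemma integration_by_parts [IsLocallyFiniteMeasure ν]
    (hu : IsSolKappaR κ u g) (hup : ∀ x, 0 < u x)
    (hv : IsSolKappaR ν v γ) {a b : ℝ} (hab : a ≤ b) :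
    u b * γ b - u a * γ a =
      (∫ t in Ioc a b, g t * γ t) + 2 * ∫ y in Ioc a b, u y * v y ∂ν := by
  have hgi : IntegrableOn g (Ioc a b) :=
    (intervalIntegrable_iff_integrableOn_Ioc_of_le hab).1 (hu.monotone_deriv hup).intervalIntegrable
  have hvi : IntegrableOn v (Ioc a b) ν := hv.1.integrableOn_Ioc
  have huvi : IntegrableOn (fun y => u y * v y) (Ioc a b) ν := (hu.1.mul hv.1).integrableOn_Ioc
  have hprod : Integrable (Function.uncurry fun s y : ℝ => (Iic s).indicator (fun y => g s * v y) y)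
      ((volume.restrict (Ioc a b)).prod (ν.restrict (Ioc a b))) :=
    (hgi.mul_prod hvi).indicator
      (measurableSet_le measurable_snd measurable_fst : MeasurableSet {z : ℝ × ℝ | z.2 ≤ z.1})
  have hswap := integral_integral_swap hprod
  have hL : ∀ s ∈ Ioc a b, ∫ y in Ioc a b, (Iic s).indicator (fun y => g s * v y) y ∂ν
      = g s * γ s / 2 - g s * γ a / 2 := by
    intro s hs
    rw [setIntegral_indicator measurableSet_Iic, Ioc_inter_Iic, min_eq_right hs.2,
      integral_const_mul]
    have := hv.2.2.2 a s hs.1.le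
    linear_combination -(g s / 2) * this
  have hR : ∀ y ∈ Ioc a b, ∫ s in Ioc a b, (Iic s).indicator (fun y => g s * v y) y
      = u b * v y - u y * v y := by
    intro y hy
    have h1 : ∀ s, (Iic s).indicator (fun y => g s * v y) y
        = (Ici y).indicator (fun s => g s * v y) s := by
      intro s; simp [indicator]
    simp_rw [h1]
    rw [setIntegral_indicator measurableSet_Ici]
    have h2 : Ioc a b ∩ Ici y = Icc y b := by
      ext t; simp only [mem_inter_iff, mem_Ioc, mem_Ici, mem_Icc]
      exact ⟨fun h => ⟨h.2, h.1.2⟩, fun h => ⟨⟨hy.1.trans_le h.1, h.2⟩, h.1⟩⟩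
    rw [h2, integral_Icc_eq_integral_Ioc, integral_mul_const,
      ← intervalIntegral.integral_of_le hy.2, hu.2.2.1 y b]
    ring
  rw [setIntegral_congr_fun measurableSet_Ioc hL, setIntegral_congr_fun measurableSet_Ioc hR,
    integral_sub (hvi.const_mul _) huvi, integral_const_mul] at hswap
  have hgγ : IntegrableOn (fun s => g s * γ s / 2) (Ioc a b) := by
    have := (hprod.integral_prod_left.congr
      ((ae_restrict_iff' measurableSet_Ioc).2 (Eventually.of_forall hL))).add
      ((hgi.mul_const (γ a)).div_const 2)
    refine this.congr (Eventually.of_forall fun s => ?_)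
    simp
  rw [integral_sub hgγ ((hgi.mul_const (γ a)).div_const 2), integral_div, integral_div,
    integral_mul_const, ← intervalIntegral.integral_of_le (f := g) hab] at hswap
  have e1 := hu.2.2.1 a b
  have e2 := hv.2.2.2 a b hab
  linear_combination -2 * hswap + u b * e2 + γ a * e1

lemma wronskian_sub [IsLocallyFiniteMeasure κ] [IsLocallyFiniteMeasure μ]
    (hu : IsSolKappaR κ u g) (hup : ∀ x, 0 < u x)
    (hv : IsSolKappaR (κ + μ) v γ) (hvp : ∀ x, 0 < v x) {a b : ℝ} (hab : a ≤ b) :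
    (u b * γ b - v b * g b) / 2 - (u a * γ a - v a * g a) / 2 = ∫ y in Ioc a b, u y * v y ∂μ := by
  have := isLocallyFiniteMeasure_add κ μ
  have h1 := hu.integration_by_parts hup hv hab
  have h2 := hv.integration_by_parts hvp hu hab
  have hi : ∀ (m : Measure ℝ) [IsLocallyFiniteMeasure m],
      IntegrableOn (fun y => u y * v y) (Ioc a b) m := fun m _ => (hu.1.mul hv.1).integrableOn_Ioc
  rw [Measure.restrict_add, integral_add_measure (hi κ) (hi μ)] at h1
  simp_rw [mul_comm (γ _) (g _), mul_comm (v _) (u _)] at h2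
  linarith

lemma deriv_nonneg (h : IsSolKappaR κ u g) (hu : ∀ x, 0 < u x) (hm : Monotone u) (x : ℝ) :
    0 ≤ g x := by
  have h1 := (h.secant_bounds hu (sub_one_lt x).le).2
  have h2 := hm (sub_one_lt x).le
  linarith

lemma deriv_nonpos (h : IsSolKappaR κ u g) (hu : ∀ x, 0 < u x) (hm : Antitone u) (x : ℝ) :
    g x ≤ 0 := by
  have h1 := (h.secant_bounds hu (lt_add_one x).le).1
  have h2 := hm (lt_add_one x).le
  linarith

lemma tendsto_deriv_atBot (h : IsSolKappaR κ u g) (hu : ∀ x, 0 < u x) (hm : Monotone u) :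
    Tendsto g atBot (𝓝 0) := by
  have hlim : Tendsto (fun x : ℝ => u 0 / -x) atBot (𝓝 0) :=
    tendsto_neg_atBot_atTop.const_div_atTop _
  refine squeeze_zero' (Eventually.of_forall (h.deriv_nonneg hu hm)) ?_ hlim
  filter_upwards [eventually_lt_atBot 0] with x hx
  rw [le_div_iff₀ (by linarith)]
  have := (h.secant_bounds hu hx.le).1
  linarith [hu x]

lemma tendsto_deriv_atTop (h : IsSolKappaR κ u g) (hu : ∀ x, 0 < u x) (hm : Antitone u) :
    Tendsto g atTop (𝓝 0) := by
  have hlim : Tendsto (fun x : ℝ => u 0 / x) atTop (𝓝 0) := tendsto_id.const_div_atTop _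
  have : Tendsto (fun x => -g x) atTop (𝓝 0) := by
    refine squeeze_zero' (Eventually.of_forall fun x => neg_nonneg.2 (h.deriv_nonpos hu hm x)) ?_
      hlim
    filter_upwards [eventually_gt_atTop 0] with x hx
    rw [le_div_iff₀ hx]
    have := (h.secant_bounds hu hx.le).2
    linarith [hu x]
  simpa using this.neg

/-- Near `-∞`, where the solutions are bounded, the mixed Wronskian vanishes. -/
lemma tendsto_wronskian_atBot (hu : IsSolKappaR κ u g) (hup : ∀ x, 0 < u x) (hum : Monotone u)
    (hv : IsSolKappaR ν v γ) (hvp : ∀ x, 0 < v x) (hvm : Monotone v) :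
    Tendsto (fun x => (u x * γ x - v x * g x) / 2) atBot (𝓝 0) := by
  have bdd : ∀ {w : ℝ → ℝ}, (∀ x, 0 < w x) → Monotone w →
      IsBoundedUnder (· ≤ ·) atBot (norm ∘ w) := fun {w} hp hm =>
    isBoundedUnder_of_eventually_le (a := w 0) <| by
      filter_upwards [eventually_le_atBot 0] with x hx
      simpa [abs_of_pos (hp x)] using hm hx
  have h1 := (hv.tendsto_deriv_atBot hvp hvm).zero_mul_isBoundedUnder_le (bdd hup hum)
  have h2 := (hu.tendsto_deriv_atBot hup hum).zero_mul_isBoundedUnder_le (bdd hvp hvm)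
  simpa [mul_comm] using (h1.sub h2).div_const 2

/-- Near `+∞`, where the solutions are bounded, the mixed Wronskian vanishes. -/
lemma tendsto_wronskian_atTop (hu : IsSolKappaR κ u g) (hup : ∀ x, 0 < u x) (hum : Antitone u)
    (hv : IsSolKappaR ν v γ) (hvp : ∀ x, 0 < v x) (hvm : Antitone v) :
    Tendsto (fun x => (u x * γ x - v x * g x) / 2) atTop (𝓝 0) := by
  have bdd : ∀ {w : ℝ → ℝ}, (∀ x, 0 < w x) → Antitone w →
      IsBoundedUnder (· ≤ ·) atTop (norm ∘ w) := fun {w} hp hm =>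
    isBoundedUnder_of_eventually_le (a := w 0) <| by
      filter_upwards [eventually_ge_atTop 0] with x hx
      simpa [abs_of_pos (hp x)] using hm hx
  have h1 := (hv.tendsto_deriv_atTop hvp hvm).zero_mul_isBoundedUnder_le (bdd hup hum)
  have h2 := (hu.tendsto_deriv_atTop hup hum).zero_mul_isBoundedUnder_le (bdd hvp hvm)
  simpa [mul_comm] using (h1.sub h2).div_const 2

/-- The product of the two solutions grows at most linearly at `-∞`. -/
lemma mul_le_of_le_neg_one (hu : ∀ x, 0 < u x) (hum : Monotone u) (hg : ∀ x, 0 ≤ g x)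
    (hv : IsSolKappaR κ v γ) (hvp : ∀ x, 0 < v x)
    (hW : ∀ x, v x * g x - u x * γ x = 2) {y : ℝ} (hy : y ≤ -1) :
    v y * u y ≤ (u 0 * v 0 + 2) * |y| := by
  rw [abs_of_neg (by linarith)]
  have h1 := (hv.secant_bounds hvp (show y ≤ 0 by linarith)).1
  have h2 := mul_le_mul_of_nonneg_left h1 (hu y).le
  have h3 := mul_le_mul_of_nonneg_right (hum (show y ≤ 0 by linarith)) (hvp 0).le
  have h4 : 0 ≤ (v y * g y) * (-y) := mul_nonneg (mul_nonneg (hvp y).le (hg y)) (by linarith)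
  have h5 : 0 ≤ (u 0 * v 0) * (-y - 1) :=
    mul_nonneg (mul_pos (hu 0) (hvp 0)).le (by linarith)
  have h6 : (v y * g y - u y * γ y) * y = 2 * y := by rw [hW y]
  linarith

/-- The product of the two solutions grows at most linearly at `+∞`. -/
lemma mul_le_of_one_le (hu : IsSolKappaR κ u g) (hup : ∀ x, 0 < u x)
    (hvp : ∀ x, 0 < v x) (hvm : Antitone v) (hγ : ∀ x, γ x ≤ 0)
    (hW : ∀ x, v x * g x - u x * γ x = 2) {y : ℝ} (hy : 1 ≤ y) :
    u y * v y ≤ (u 0 * v 0 + 2) * |y| := by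
  rw [abs_of_pos (by linarith)]
  have h1 := (hu.secant_bounds hup (show 0 ≤ y by linarith)).2
  have h2 := mul_le_mul_of_nonneg_left h1 (hvp y).le
  have h3 := mul_le_mul_of_nonneg_right (hvm (show 0 ≤ y by linarith)) (hup 0).le
  have h4 : 0 ≤ (u y * -γ y) * y :=
    mul_nonneg (mul_nonneg (hup y).le (neg_nonneg.2 (hγ y))) (by linarith)
  have h5 : 0 ≤ (u 0 * v 0) * (y - 1) :=
    mul_nonneg (mul_pos (hup 0) (hvp 0)).le (by linarith)
  have h6 : (v y * g y - u y * γ y) * y = 2 * y := by rw [hW y]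
  linarith

end IsSolKappaR

lemma integrableOn_of_le_mul_abs {μ : Measure ℝ} {f : ℝ → ℝ}
    (hμ : (∫⁻ x, ENNReal.ofReal |x| ∂μ) < ⊤) {s : Set ℝ}
    (hs : MeasurableSet s) (hf : Continuous f) (hf0 : ∀ x, 0 ≤ f x) {C : ℝ}
    (hC : ∀ x ∈ s, f x ≤ C * |x|) : IntegrableOn f s μ := by
  have habs : Integrable (fun x : ℝ => |x|) μ := by
    refine ⟨continuous_abs.aestronglyMeasurable, ?_⟩
    simpa [HasFiniteIntegral, Real.enorm_eq_ofReal_abs] using hμ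
  refine (habs.const_mul C).integrableOn.mono' hf.aestronglyMeasurable ?_
  refine (ae_restrict_iff' hs).2 (Eventually.of_forall fun x hx => ?_)
  rw [Real.norm_of_nonneg (hf0 x)]
  exact hC x hx

section Primitives

variable {μ : Measure ℝ} [IsLocallyFiniteMeasure μ] {f A : ℝ → ℝ} {c : ℝ}

lemma integral_Iic_of_sub_eq (hf : Continuous f) (hf0 : ∀ x, 0 ≤ f x)
    (hA : ∀ a b, a ≤ b → A b - A a = ∫ t in Ioc a b, f t ∂μ) (hlim : Tendsto A atBot (𝓝 c))
    (x : ℝ) : IntegrableOn f (Iic x) μ ∧ ∫ t in Iic x, f t ∂μ = A x - c := by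
  have ht : Tendsto (fun a => ∫ t in a..x, f t ∂μ) atBot (𝓝 (A x - c)) := by
    refine (hlim.const_sub (A x)).congr' ?_
    filter_upwards [eventually_le_atBot x] with a ha
    rw [intervalIntegral.integral_of_le ha, hA a x ha]
  have hi : IntegrableOn f (Iic x) μ :=
    integrableOn_Iic_of_intervalIntegral_norm_tendsto _ x (fun _ => hf.integrableOn_Ioc)
      tendsto_id (by simpa only [Real.norm_of_nonneg (hf0 _), id] using ht)
  exact ⟨hi, tendsto_nhds_unique (intervalIntegral_tendsto_integral_Iic x hi tendsto_id) ht⟩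

lemma integral_Ioi_of_sub_eq (hf : Continuous f) (hf0 : ∀ x, 0 ≤ f x)
    (hA : ∀ a b, a ≤ b → A b - A a = ∫ t in Ioc a b, f t ∂μ) (hlim : Tendsto A atTop (𝓝 c))
    (x : ℝ) : IntegrableOn f (Ioi x) μ ∧ ∫ t in Ioi x, f t ∂μ = c - A x := by
  have ht : Tendsto (fun b => ∫ t in x..b, f t ∂μ) atTop (𝓝 (c - A x)) := by
    refine (hlim.sub_const (A x)).congr' ?_
    filter_upwards [eventually_ge_atTop x] with b hb
    rw [intervalIntegral.integral_of_le hb, hA x b hb]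
  have hi : IntegrableOn f (Ioi x) μ :=
    integrableOn_Ioi_of_intervalIntegral_norm_tendsto _ x (fun _ => hf.integrableOn_Ioc)
      tendsto_id (by simpa only [Real.norm_of_nonneg (hf0 _), id] using ht)
  exact ⟨hi, tendsto_nhds_unique (intervalIntegral_tendsto_integral_Ioi x hi tendsto_id) ht⟩

lemma exists_integral_Iic_lt_one (hf : Continuous f) {a : ℝ} (hfi : IntegrableOn f (Iic a) μ) :
    ∃ x ≤ a, ∫ t in Iic x, f t ∂μ < 1 := by
  have ht := intervalIntegral_tendsto_integral_Iic a hfi tendsto_id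
  have he := ht.eventually (lt_mem_nhds (sub_one_lt _))
  obtain ⟨x, hx, hxa⟩ := (he.and (eventually_le_atBot a)).exists
  refine ⟨x, hxa, ?_⟩
  have hd := setIntegral_union (Iic_disjoint_Ioc le_rfl) measurableSet_Ioc
    (hfi.mono_set (Iic_subset_Iic.2 hxa)) (hf.integrableOn_Ioc (μ := μ) (a := x) (b := a))
  rw [Iic_union_Ioc_eq_Iic hxa] at hd
  rw [id, intervalIntegral.integral_of_le hxa] at hx
  linarith

lemma exists_integral_Ioi_lt_one (hf : Continuous f) {a : ℝ} (hfi : IntegrableOn f (Ioi a) μ) :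
    ∃ x ≥ a, ∫ t in Ioi x, f t ∂μ < 1 := by
  have ht := intervalIntegral_tendsto_integral_Ioi a hfi tendsto_id
  have he := ht.eventually (lt_mem_nhds (sub_one_lt _))
  obtain ⟨x, hx, hxa⟩ := (he.and (eventually_ge_atTop a)).exists
  refine ⟨x, hxa, ?_⟩
  have hd := setIntegral_union (Ioc_disjoint_Ioi le_rfl) measurableSet_Ioi
    (hf.integrableOn_Ioc (μ := μ) (a := a) (b := x)) (hfi.mono_set (Ioi_subset_Ioi hxa))
  rw [Ioc_union_Ioi_eq_Ioi hxa] at hd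
  rw [id, intervalIntegral.integral_of_le hxa] at hx
  linarith

end Primitives

lemma pos_of_integral_eq_sub {μ : Measure ℝ} {s : Set ℝ} (hs : MeasurableSet s) {f k : ℝ → ℝ}
    (hf : IntegrableOn f s μ) (hk : IntegrableOn k s μ) {K c : ℝ} (hK : 0 < K)
    (hle : ∀ x ∈ s, f x ≤ K * k x) (hk1 : ∫ x in s, k x ∂μ < 1)
    (he : ∫ x in s, f x ∂μ = K - c) : 0 < c := by
  have h := setIntegral_mono_on hf (hk.const_mul K) hs hle
  rw [integral_const_mul, he] at h
  nlinarith

/-- Comparison near `-∞` of the increasing solutions for `κ` and `κ + μ`. -/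
lemma exists_comparison_Iio {κ μ : Measure ℝ} [IsLocallyFiniteMeasure κ] [IsLocallyFiniteMeasure μ]
    (hμ : (∫⁻ x, ENNReal.ofReal |x| ∂μ) < ⊤) {u d g h v γ : ℝ → ℝ}
    (hu : IsSolKappaR κ u g) (hd : IsSolKappaR κ d h)
    (hup : ∀ x, 0 < u x) (hum : Monotone u) (hdp : ∀ x, 0 < d x) (hda : Antitone d)
    (hW : ∀ x, d x * g x - u x * h x = 2)
    (hv : IsSolKappaR (κ + μ) v γ) (hvp : ∀ x, 0 < v x) (hvm : Monotone v) :
    ∃ c : ℝ, 0 < c ∧ ∀ x : ℝ,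
      ∫ y in Iio x, (d y * u x - u y * d x) * v y ∂μ = v x - c * u x := by
  set A : ℝ → ℝ := fun x => (d x * γ x - v x * h x) / 2 with hAdef
  set B : ℝ → ℝ := fun x => (u x * γ x - v x * g x) / 2 with hBdef
  have hvAB : ∀ x, v x = A x * u x - B x * d x := fun x => by
    simp only [hAdef, hBdef]; linear_combination -(v x / 2) * hW x
  have hA : ∀ a b, a ≤ b → A b - A a = ∫ y in Ioc a b, d y * v y ∂μ :=
    fun a b hab => hd.wronskian_sub hdp hv hvp hab
  have hB : ∀ a b, a ≤ b → B b - B a = ∫ y in Ioc a b, u y * v y ∂μ :=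
    fun a b hab => hu.wronskian_sub hup hv hvp hab
  have hdv : ∀ x, 0 ≤ d x * v x := fun x => (mul_pos (hdp x) (hvp x)).le
  have huv : ∀ x, 0 ≤ u x * v x := fun x => (mul_pos (hup x) (hvp x)).le
  have hdu : ∀ x, 0 ≤ d x * u x := fun x => (mul_pos (hdp x) (hup x)).le
  have hA0 : ∀ x, 0 ≤ A x := fun x => by
    have h1 := mul_nonneg (hdp x).le (hv.deriv_nonneg hvp hvm x)
    have h2 := mul_nonneg (hvp x).le (neg_nonneg.2 (hd.deriv_nonpos hdp hda x))
    simp only [hAdef]; linarith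
  have hAm : Monotone A := fun a b hab => by
    have h1 := hA a b hab
    have h2 : 0 ≤ ∫ y in Ioc a b, d y * v y ∂μ := integral_nonneg hdv
    linarith
  have hAlim := tendsto_atBot_ciInf hAm ⟨0, by rintro _ ⟨x, rfl⟩; exact hA0 x⟩
  set c := ⨅ x, A x
  have hIA := integral_Iic_of_sub_eq (f := fun y => d y * v y) (hd.1.mul hv.1) hdv hA hAlim
  have hIB := integral_Iic_of_sub_eq (f := fun y => u y * v y) (hu.1.mul hv.1) huv hB
    (hu.tendsto_wronskian_atBot hup hum hv hvp hvm)
  refine ⟨c, ?_, fun x => ?_⟩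
  · have hB0 : ∀ x, 0 ≤ B x := fun x => by
      have h1 := (hIB x).2
      have h2 : 0 ≤ ∫ y in Iic x, u y * v y ∂μ := integral_nonneg huv
      linarith
    have hvle : ∀ x, v x ≤ A x * u x := fun x => by
      have := mul_nonneg (hB0 x) (hdp x).le
      linarith [hvAB x]
    have hdui : IntegrableOn (fun y => d y * u y) (Iic (-1)) μ :=
      integrableOn_of_le_mul_abs hμ measurableSet_Iic (hd.1.mul hu.1) hdu fun y hy =>
        IsSolKappaR.mul_le_of_le_neg_one hup hum (hu.deriv_nonneg hup hum) hd hdp hW hy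
    obtain ⟨x, hx, hx1⟩ := exists_integral_Iic_lt_one (hd.1.mul hu.1) hdui
    refine pos_of_integral_eq_sub measurableSet_Iic (hIA x).1
      (hdui.mono_set (Iic_subset_Iic.2 hx))
      (pos_of_mul_pos_left ((hvp x).trans_le (hvle x)) (hup x).le) (fun y hy => ?_) hx1 (hIA x).2
    calc d y * v y ≤ d y * (A y * u y) := mul_le_mul_of_nonneg_left (hvle y) (hdp y).le
      _ = A y * (d y * u y) := by ring
      _ ≤ A x * (d y * u y) := mul_le_mul_of_nonneg_right (hAm hy) (hdu y)
  · have hIic : ∫ y in Iio x, (d y * u x - u y * d x) * v y ∂μ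
        = ∫ y in Iic x, (d y * u x - u y * d x) * v y ∂μ := by
      refine (setIntegral_eq_of_subset_of_forall_sdiff_eq_zero measurableSet_Iic
        Iio_subset_Iic_self fun y hy => ?_).symm
      have : y = x := le_antisymm hy.1 (not_lt.1 hy.2)
      rw [this]; ring
    have hsplit : ∀ y, (d y * u x - u y * d x) * v y
        = u x * (d y * v y) - d x * (u y * v y) := fun y => by ring
    simp_rw [hIic, hsplit]
    rw [integral_sub ((hIA x).1.const_mul _) ((hIB x).1.const_mul _), integral_const_mul,
      integral_const_mul, (hIA x).2, (hIB x).2]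
    linear_combination -hvAB x

/-- Comparison near `+∞` of the decreasing solutions for `κ` and `κ + μ`. -/
lemma exists_comparison_Ioi {κ μ : Measure ℝ} [IsLocallyFiniteMeasure κ] [IsLocallyFiniteMeasure μ]
    (hμ : (∫⁻ x, ENNReal.ofReal |x| ∂μ) < ⊤) {u d g h v γ : ℝ → ℝ}
    (hu : IsSolKappaR κ u g) (hd : IsSolKappaR κ d h)
    (hup : ∀ x, 0 < u x) (hum : Monotone u) (hdp : ∀ x, 0 < d x) (hda : Antitone d)
    (hW : ∀ x, d x * g x - u x * h x = 2)
    (hv : IsSolKappaR (κ + μ) v γ) (hvp : ∀ x, 0 < v x) (hva : Antitone v) :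
    ∃ c : ℝ, 0 < c ∧ ∀ x : ℝ,
      ∫ y in Ioi x, (u y * d x - d y * u x) * v y ∂μ = v x - c * d x := by
  set A : ℝ → ℝ := fun x => (u x * γ x - v x * g x) / 2 with hAdef
  set B : ℝ → ℝ := fun x => (d x * γ x - v x * h x) / 2 with hBdef
  have hvAB : ∀ x, v x = B x * u x - A x * d x := fun x => by
    simp only [hAdef, hBdef]; linear_combination -(v x / 2) * hW x
  have hA : ∀ a b, a ≤ b → A b - A a = ∫ y in Ioc a b, u y * v y ∂μ :=
    fun a b hab => hu.wronskian_sub hup hv hvp hab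
  have hB : ∀ a b, a ≤ b → B b - B a = ∫ y in Ioc a b, d y * v y ∂μ :=
    fun a b hab => hd.wronskian_sub hdp hv hvp hab
  have hdv : ∀ x, 0 ≤ d x * v x := fun x => (mul_pos (hdp x) (hvp x)).le
  have huv : ∀ x, 0 ≤ u x * v x := fun x => (mul_pos (hup x) (hvp x)).le
  have hud : ∀ x, 0 ≤ u x * d x := fun x => (mul_pos (hup x) (hdp x)).le
  have hA0 : ∀ x, A x ≤ 0 := fun x => by
    have h1 := mul_nonneg (hup x).le (neg_nonneg.2 (hv.deriv_nonpos hvp hva x))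
    have h2 := mul_nonneg (hvp x).le (hu.deriv_nonneg hup hum x)
    simp only [hAdef]; linarith
  have hAm : Monotone A := fun a b hab => by
    have h1 := hA a b hab
    have h2 : 0 ≤ ∫ y in Ioc a b, u y * v y ∂μ := integral_nonneg huv
    linarith
  have hAlim := tendsto_atTop_ciSup hAm ⟨0, by rintro _ ⟨x, rfl⟩; exact hA0 x⟩
  set c := ⨆ x, A x
  have hIA := integral_Ioi_of_sub_eq (f := fun y => u y * v y) (hu.1.mul hv.1) huv hA hAlim
  have hIB := integral_Ioi_of_sub_eq (f := fun y => d y * v y) (hd.1.mul hv.1) hdv hB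
    (hd.tendsto_wronskian_atTop hdp hda hv hvp hva)
  refine ⟨-c, ?_, fun x => ?_⟩
  · have hB0 : ∀ x, B x ≤ 0 := fun x => by
      have h1 := (hIB x).2
      have h2 : 0 ≤ ∫ y in Ioi x, d y * v y ∂μ := integral_nonneg hdv
      linarith
    have hvle : ∀ x, v x ≤ -A x * d x := fun x => by
      have := mul_nonneg (neg_nonneg.2 (hB0 x)) (hup x).le
      linarith [hvAB x]
    have hudi : IntegrableOn (fun y => u y * d y) (Ioi 1) μ :=
      integrableOn_of_le_mul_abs hμ measurableSet_Ioi (hu.1.mul hd.1) hud fun y hy =>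
        hu.mul_le_of_one_le hup hdp hda (hd.deriv_nonpos hdp hda) hW (le_of_lt hy)
    obtain ⟨x, hx, hx1⟩ := exists_integral_Ioi_lt_one (hu.1.mul hd.1) hudi
    refine pos_of_integral_eq_sub measurableSet_Ioi (hIA x).1
      (hudi.mono_set (Ioi_subset_Ioi hx))
      (pos_of_mul_pos_left ((hvp x).trans_le (hvle x)) (hdp x).le) (fun y hy => ?_) hx1
      ((hIA x).2.trans (by ring))
    calc u y * v y ≤ u y * (-A y * d y) := mul_le_mul_of_nonneg_left (hvle y) (hup y).le
      _ = -A y * (u y * d y) := by ring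
      _ ≤ -A x * (u y * d y) :=
        mul_le_mul_of_nonneg_right (neg_le_neg (hAm (le_of_lt hy))) (hud y)
  · have hsplit : ∀ y, (u y * d x - d y * u x) * v y
        = d x * (u y * v y) - u x * (d y * v y) := fun y => by ring
    simp_rw [hsplit]
    rw [integral_sub ((hIA x).1.const_mul _) ((hIB x).1.const_mul _), integral_const_mul,
      integral_const_mul, (hIA x).2, (hIB x).2]
    linear_combination -hvAB x

/-- comparison identities between the normalized solution pairs for
`κ` and `κ̃ = κ + μ`, where `μ = κ̃ − κ` has a finite first moment. -/
theorem comparison_identities_two_killing_measures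
    (κ μ : Measure ℝ) [IsLocallyFiniteMeasure κ] [IsLocallyFiniteMeasure μ]
    (hκ0 : κ ≠ 0) (hκμ0 : κ + μ ≠ 0)
    (hμmom : (∫⁻ x, ENNReal.ofReal |x| ∂μ) < ⊤)
    (uup udown gup gdown : ℝ → ℝ)
    (hup : IsSolKappaR κ uup gup) (hdown : IsSolKappaR κ udown gdown)
    (huppos : ∀ x, 0 < uup x) (hupmono : Monotone uup)
    (hdownpos : ∀ x, 0 < udown x) (hdownanti : Antitone udown)
    (hW : ∀ x, udown x * gup x - uup x * gdown x = 2)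
    (tup tdown tgup tgdown : ℝ → ℝ)
    (htup : IsSolKappaR (κ + μ) tup tgup) (htdown : IsSolKappaR (κ + μ) tdown tgdown)
    (htuppos : ∀ x, 0 < tup x) (htupmono : Monotone tup)
    (htdownpos : ∀ x, 0 < tdown x) (htdownanti : Antitone tdown)
    (htW : ∀ x, tdown x * tgup x - tup x * tgdown x = 2) :
    ∃ c₁ c₂ : ℝ, 0 < c₁ ∧ 0 < c₂ ∧ ∀ x : ℝ,
      (∫ y in Iio x, (udown y * uup x - uup y * udown x) * tup y ∂μ)
          = tup x - c₁ * uup x ∧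
      (∫ y in Ioi x, (uup y * udown x - udown y * uup x) * tdown y ∂μ)
          = tdown x - c₂ * udown x := by
  obtain ⟨c₁, h₁, H₁⟩ := exists_comparison_Iio hμmom hup hdown huppos hupmono hdownpos hdownanti
    hW htup htuppos htupmono
  obtain ⟨c₂, h₂, H₂⟩ := exists_comparison_Ioi hμmom hup hdown huppos hupmono hdownpos hdownanti
    hW htdown htdownpos htdownanti
  exact ⟨c₁, c₂, h₁, h₂, fun x => ⟨H₁ x, H₂ x⟩⟩
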